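/- arXiv:2603.01368 — 5 statements merged into one kernel-verified Lean document; each statement's English description precedes it below -/
import Mathlib

section
/- Let n ≥ 4 and 2 ≤ k ≤ n − 2 with k ≡ 1 (mod 4). Then H_k, the F_2-span of the clique vectors {v_X : X ⊆ [n], |X| = k}, equals ker(∂) ∩ ker(e), the subspace of F_2^{C(n,2)} consisting of edge-sets of even size in which every vertex has even degree. -/
open scoped BigOperators

/-- Index type for the coordinates of `F_2^{C(n,2)}`, i.e. for the edges of the complete
graph `K_n`: unordered pairs `{i,j} ⊆ [n]`, represented as ordered pairs `(i,j)` with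
`i < j`. -/
def PairIdx (n : ℕ) := {p : Fin n × Fin n // p.1 < p.2}

instance (n : ℕ) : Fintype (PairIdx n) := by unfold PairIdx; infer_instance
instance (n : ℕ) : DecidableEq (PairIdx n) := by unfold PairIdx; infer_instance

/-- The clique vector `v_X ∈ F_2^{C(n,2)}`: the edge set of the clique on `X`, i.e. the
coordinate at `{i,j}` is `1` iff `{i,j} ⊆ X`. -/
def cliqueVec (n : ℕ) (X : Finset (Fin n)) : PairIdx n → ZMod 2 :=
  fun p => if p.1.1 ∈ X ∧ p.1.2 ∈ X then 1 else 0

/-- `H_k`: the `F_2`-linear span of the clique vectors `{v_X : X ⊆ [n], |X| = k}`. -/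
def Hk (n k : ℕ) : Submodule (ZMod 2) (PairIdx n → ZMod 2) :=
  Submodule.span (ZMod 2) {v | ∃ X : Finset (Fin n), X.card = k ∧ cliqueVec n X = v}

/-- The edge-count parity map `e : F_2^{C(n,2)} → F_2`, `e(F) = |F| mod 2`. -/
def eMap (n : ℕ) : (PairIdx n → ZMod 2) →ₗ[ZMod 2] ZMod 2 :=
  ∑ p : PairIdx n, LinearMap.proj p

/-- The degree-parity map `∂ : F_2^{C(n,2)} → F_2^n`, `∂(F)_v = deg_F(v) mod 2`. -/
def dMap (n : ℕ) : (PairIdx n → ZMod 2) →ₗ[ZMod 2] (Fin n → ZMod 2) :=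
  LinearMap.pi fun v =>
    ∑ p ∈ Finset.univ.filter (fun p : PairIdx n => p.1.1 = v ∨ p.1.2 = v),
      LinearMap.proj p

/-- Summing `g i j + g j i` over unordered pairs, plus the diagonal, is summing over all
ordered pairs. -/
lemma sum_pairIdx_add_diag {M : Type*} [AddCommMonoid M] (n : ℕ) (g : Fin n → Fin n → M) :
    ∑ p : PairIdx n, (g p.1.1 p.1.2 + g p.1.2 p.1.1) + ∑ i, g i i = ∑ i, ∑ j, g i j := by
  have hsub (h : Fin n × Fin n → M) :
      ∑ p : PairIdx n, h p.1 = ∑ q : Fin n × Fin n, if q.1 < q.2 then h q else 0 := by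
    rw [← Finset.sum_filter]
    exact (Finset.sum_subtype _ (by simp) h).symm
  have hdiag : ∑ i, g i i = ∑ q : Fin n × Fin n, if q.1 = q.2 then g q.1 q.2 else 0 := by
    simp [Fintype.sum_prod_type]
  have hswap : (∑ q : Fin n × Fin n, if q.1 < q.2 then g q.2 q.1 else 0) =
      ∑ q : Fin n × Fin n, if q.2 < q.1 then g q.1 q.2 else 0 :=
    Fintype.sum_equiv (Equiv.prodComm _ _) _ _ fun _ => rfl
  rw [Finset.sum_add_distrib, hsub fun q => g q.1 q.2, hsub fun q => g q.2 q.1, hswap, hdiag,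
    ← Finset.sum_add_distrib, ← Finset.sum_add_distrib, ← Fintype.sum_prod_type']
  refine Finset.sum_congr rfl fun q _ => ?_
  rcases lt_trichotomy q.1 q.2 with h | h | h
  · simp [h, h.ne, h.not_gt]
  · simp [h]
  · simp [h, h.ne', h.not_gt]

/-- The indicator function of a vertex, with values in `F_2`. -/
def vertexInd (n : ℕ) (a i : Fin n) : ZMod 2 := if i = a then 1 else 0

/-- The indicator vector of the edge `{a, b}`; it is zero when `a = b`. -/
def edgeVec (n : ℕ) (a b : Fin n) : PairIdx n → ZMod 2 := fun p =>
  vertexInd n a p.1.1 * vertexInd n b p.1.2 + vertexInd n b p.1.1 * vertexInd n a p.1.2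

/-- The edge set of the triangle on `a, b, c`. -/
def triVec (n : ℕ) (a b c : Fin n) : PairIdx n → ZMod 2 :=
  edgeVec n a b + edgeVec n b c + edgeVec n a c

lemma edgeVec_comm (n : ℕ) (a b : Fin n) : edgeVec n a b = edgeVec n b a := by
  funext p
  simp only [edgeVec]
  ring

lemma edgeVec_self (n : ℕ) (a : Fin n) : edgeVec n a a = 0 := by
  funext p
  exact CharTwo.add_self_eq_zero _

lemma triVec_swap_right (n : ℕ) (a b c : Fin n) : triVec n a b c = triVec n a c b := by
  rw [triVec, triVec, edgeVec_comm n b c]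
  abel

lemma triVec_self_left (n : ℕ) (a b : Fin n) : triVec n a a b = 0 := by
  rw [triVec, edgeVec_self, zero_add]
  funext p
  exact CharTwo.add_self_eq_zero (edgeVec n a b p)

lemma cliqueVec_insert_insert (n : ℕ) {W : Finset (Fin n)} {a b : Fin n} (ha : a ∉ W)
    (hb : b ∉ W) (hab : a ≠ b) (p : PairIdx n) :
    cliqueVec n (insert a (insert b W)) p =
      ((if p.1.1 ∈ W then 1 else 0) + vertexInd n a p.1.1 + vertexInd n b p.1.1) *
      ((if p.1.2 ∈ W then 1 else 0) + vertexInd n a p.1.2 + vertexInd n b p.1.2) := by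
  have key (i : Fin n) : (if i ∈ insert a (insert b W) then 1 else 0 : ZMod 2) =
      (if i ∈ W then 1 else 0) + vertexInd n a i + vertexInd n b i := by
    simp only [vertexInd, Finset.mem_insert]
    by_cases h1 : i = a
    · subst h1; simp [ha, hab]
    · by_cases h2 : i = b
      · subst h2; simp [hb, h1]
      · simp [h1, h2]
  rw [← key, ← key, cliqueVec]
  split_ifs <;> simp_all

lemma cliqueVec_mem_Hk (n k : ℕ) {X : Finset (Fin n)} (h : X.card = k) :
    cliqueVec n X ∈ Hk n k :=
  Submodule.subset_span ⟨X, h, rfl⟩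

/-- Two triangles sharing an edge are congruent modulo `H_k`. -/
lemma triVec_sub_mem_Hk_of_ne (n k : ℕ) (hn : 4 ≤ n) (hk2 : 2 ≤ k) (hkn : k ≤ n - 2)
    {a b c d : Fin n} (hab : a ≠ b) (hac : a ≠ c) (had : a ≠ d) (hbc : b ≠ c) (hbd : b ≠ d)
    (hcd : c ≠ d) : triVec n a b c - triVec n a b d ∈ Hk n k := by
  obtain ⟨W, hW, hWc⟩ := Finset.exists_subset_card_eq
    (s := ({a, b, c, d} : Finset (Fin n))ᶜ) (n := k - 2) (by
      have h4 : ({a, b, c, d} : Finset (Fin n)).card ≤ 4 := Finset.card_le_four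
      rw [Finset.card_compl, Fintype.card_fin]
      omega)
  have haW : a ∉ W := fun h => by simpa using hW h
  have hbW : b ∉ W := fun h => by simpa using hW h
  have hcW : c ∉ W := fun h => by simpa using hW h
  have hdW : d ∉ W := fun h => by simpa using hW h
  have hmem {x y : Fin n} (hx : x ∉ W) (hy : y ∉ W) (hxy : x ≠ y) :
      cliqueVec n (insert x (insert y W)) ∈ Hk n k := by
    apply cliqueVec_mem_Hk
    rw [Finset.card_insert_of_notMem (by simp [hx, hxy]), Finset.card_insert_of_notMem hy]
    omega
  have hsum : triVec n a b c - triVec n a b d =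
      cliqueVec n (insert a (insert c W)) + cliqueVec n (insert b (insert c W)) +
      cliqueVec n (insert a (insert d W)) + cliqueVec n (insert b (insert d W)) := by
    funext p
    simp only [Pi.add_apply, Pi.sub_apply, triVec, edgeVec,
      cliqueVec_insert_insert n haW hcW hac, cliqueVec_insert_insert n hbW hcW hbc,
      cliqueVec_insert_insert n haW hdW had, cliqueVec_insert_insert n hbW hdW hbd]
    ring_nf
    reduce_mod_char
  rw [hsum]
  exact add_mem (add_mem (add_mem (hmem haW hcW hac) (hmem hbW hcW hbc)) (hmem haW hdW had))
    (hmem hbW hdW hbd)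

/-- Two nondegenerate triangles with a common vertex are congruent modulo `H_k`. -/
lemma triVec_sub_mem_Hk (n k : ℕ) (hn : 4 ≤ n) (hk2 : 2 ≤ k) (hkn : k ≤ n - 2)
    {o u v x y : Fin n} (hou : o ≠ u) (hov : o ≠ v) (huv : u ≠ v) (hox : o ≠ x) (hoy : o ≠ y)
    (hxy : x ≠ y) : triVec n o u v - triVec n o x y ∈ Hk n k := by
  have step {a b c : Fin n} (ha : o ≠ a) (hb : o ≠ b) (hc : o ≠ c) (hab : a ≠ b) (hac : a ≠ c) :
      triVec n o a b - triVec n o a c ∈ Hk n k := by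
    by_cases hbc : b = c
    · simp [hbc]
    · exact triVec_sub_mem_Hk_of_ne n k hn hk2 hkn ha hb hc hab hac hbc
  by_cases hux : u = x
  · subst hux
    exact step hou hov hoy huv hxy
  · have h1 := step hou hov hox huv hux
    rw [triVec_swap_right n o u x] at h1
    simpa using add_mem h1 (step hox hou hoy (Ne.symm hux) hxy)

lemma dMap_apply_eq (n : ℕ) (F : PairIdx n → ZMod 2) (v : Fin n) :
    dMap n F v = ∑ p, F p * (vertexInd n v p.1.1 + vertexInd n v p.1.2) := by
  simp only [dMap, LinearMap.pi_apply, LinearMap.sum_apply, LinearMap.proj_apply]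
  rw [Finset.sum_filter]
  refine Finset.sum_congr rfl fun p _ => ?_
  have hp := p.2.ne
  by_cases h1 : p.1.1 = v
  · have h2 : p.1.2 ≠ v := fun h => hp (h1.trans h.symm)
    simp [vertexInd, h1, h2]
  · simp [vertexInd, h1]

lemma eMap_apply_eq (n : ℕ) (F : PairIdx n → ZMod 2) : eMap n F = ∑ p, F p := by
  simp [eMap]

lemma sum_smul_edgeVec (n : ℕ) (F : PairIdx n → ZMod 2) :
    ∑ p : PairIdx n, F p • edgeVec n p.1.1 p.1.2 = F := by
  funext q
  rw [Finset.sum_apply, Finset.sum_eq_single q]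
  · have hq : q.1.1 ≠ q.1.2 := q.2.ne
    simp [edgeVec, vertexInd, hq]
  · intro p _ hpq
    have h1 : ¬(q.1.1 = p.1.1 ∧ q.1.2 = p.1.2) := fun h =>
      hpq (Subtype.ext (Prod.ext h.1.symm h.2.symm))
    have h2 : ¬(q.1.1 = p.1.2 ∧ q.1.2 = p.1.1) := fun h => by
      have hp := p.2
      have hq := q.2
      rw [h.1, h.2] at hq
      exact lt_asymm hp hq
    simp only [Pi.smul_apply, edgeVec, vertexInd, ← ite_and, mul_ite, mul_one, mul_zero]
    rw [and_comm] at h1 h2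
    simp [h1, h2]
  · simp

lemma edgeVec_eq_sum (n : ℕ) (o a : Fin n) :
    edgeVec n o a = ∑ v, vertexInd n v a • edgeVec n o v := by
  simp [vertexInd]

/-- An even-degree edge set is the sum of the triangles joining its edges to a fixed vertex. -/
lemma sum_smul_triVec (n : ℕ) (F : PairIdx n → ZMod 2) (hF : dMap n F = 0) (o : Fin n) :
    ∑ p : PairIdx n, F p • triVec n o p.1.1 p.1.2 = F := by
  have hstar : ∑ p : PairIdx n, F p • (edgeVec n o p.1.1 + edgeVec n o p.1.2) = 0 := by
    calc ∑ p : PairIdx n, F p • (edgeVec n o p.1.1 + edgeVec n o p.1.2)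
        = ∑ p : PairIdx n, ∑ v,
            (F p * (vertexInd n v p.1.1 + vertexInd n v p.1.2)) • edgeVec n o v := by
          refine Finset.sum_congr rfl fun p _ => ?_
          rw [edgeVec_eq_sum n o p.1.1, edgeVec_eq_sum n o p.1.2, ← Finset.sum_add_distrib,
            Finset.smul_sum]
          refine Finset.sum_congr rfl fun v _ => ?_
          rw [← add_smul, smul_smul]
      _ = ∑ v, dMap n F v • edgeVec n o v := by
          rw [Finset.sum_comm]
          refine Finset.sum_congr rfl fun v _ => ?_
          rw [dMap_apply_eq, Finset.sum_smul]
      _ = 0 := by simp [hF]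
  calc ∑ p : PairIdx n, F p • triVec n o p.1.1 p.1.2
      = ∑ p : PairIdx n, F p • edgeVec n p.1.1 p.1.2 +
          ∑ p : PairIdx n, F p • (edgeVec n o p.1.1 + edgeVec n o p.1.2) := by
        rw [← Finset.sum_add_distrib]
        refine Finset.sum_congr rfl fun p _ => ?_
        rw [← smul_add, triVec]
        congr 1
        abel
    _ = F := by rw [hstar, sum_smul_edgeVec, add_zero]

lemma mem_Hk_of_even (n k : ℕ) (hn : 4 ≤ n) (hk2 : 2 ≤ k) (hkn : k ≤ n - 2)
    (F : PairIdx n → ZMod 2) (hd : dMap n F = 0) (he : eMap n F = 0) : F ∈ Hk n k := by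
  let o : Fin n := ⟨0, by omega⟩
  let x : Fin n := ⟨1, by omega⟩
  let y : Fin n := ⟨2, by omega⟩
  have hox : o ≠ x := by simp [o, x]
  have hoy : o ≠ y := by simp [o, y]
  have hxy : x ≠ y := by simp [x, y]
  have hzero : ∑ p : PairIdx n, F p * (1 - (vertexInd n o p.1.1 + vertexInd n o p.1.2)) = 0 := by
    simp only [mul_sub, mul_one, Finset.sum_sub_distrib]
    rw [← dMap_apply_eq, ← eMap_apply_eq, hd, he]
    simp
  have hF : F = ∑ p : PairIdx n, F p • (triVec n o p.1.1 p.1.2 -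
      (1 - (vertexInd n o p.1.1 + vertexInd n o p.1.2)) • triVec n o x y) := by
    simp only [smul_sub, Finset.sum_sub_distrib, smul_smul]
    rw [sum_smul_triVec n F hd, ← Finset.sum_smul, hzero, zero_smul, sub_zero]
  rw [hF]
  refine sum_mem fun p _ => Submodule.smul_mem _ _ ?_
  have hp : p.1.1 ≠ p.1.2 := p.2.ne
  by_cases h1 : p.1.1 = o
  · have h2 : p.1.2 ≠ o := fun h => hp (h1.trans h.symm)
    simp [vertexInd, h1, h2, triVec_self_left]
  · by_cases h2 : p.1.2 = o
    · simp [vertexInd, h1, h2, triVec_swap_right n o _ o, triVec_self_left]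
    · simpa [vertexInd, h1, h2] using
        triVec_sub_mem_Hk n k hn hk2 hkn (Ne.symm h1) (Ne.symm h2) hp hox hoy hxy

lemma dMap_cliqueVec (n : ℕ) (X : Finset (Fin n)) (hX : Odd X.card) :
    dMap n (cliqueVec n X) = 0 := by
  funext v
  let χ : Fin n → ZMod 2 := fun i => if i ∈ X then 1 else 0
  have h := sum_pairIdx_add_diag n fun i j => χ i * χ j * vertexInd n v i
  have hsum : ∑ i, χ i = 1 := by
    simpa [χ] using (ZMod.natCast_eq_one_iff_odd).2 hX
  have hsq (i : Fin n) : χ i * χ i = χ i := by simp [χ]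
  have hfull : ∑ i, ∑ j, χ i * χ j * vertexInd n v i = χ v := by
    simp_rw [mul_right_comm, ← Finset.mul_sum, hsum]
    simp [vertexInd]
  have hdiag : ∑ i, χ i * χ i * vertexInd n v i = χ v := by
    simp [hsq, vertexInd]
  rw [hfull, hdiag, add_eq_right] at h
  rw [dMap_apply_eq, Pi.zero_apply, ← h]
  refine Finset.sum_congr rfl fun p _ => ?_
  have hp : cliqueVec n X p = χ p.1.1 * χ p.1.2 := by
    simp only [cliqueVec, χ]
    split_ifs <;> simp_all
  rw [hp]
  ring

lemma eMap_cliqueVec (n : ℕ) (X : Finset (Fin n)) (hX : X.card % 4 = 1) :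
    eMap n (cliqueVec n X) = 0 := by
  let χ : Fin n → ℕ := fun i => if i ∈ X then 1 else 0
  have h := sum_pairIdx_add_diag n fun i j => χ i * χ j
  have hsum : ∑ i, χ i = X.card := by simp [χ]
  have hsq (i : Fin n) : χ i * χ i = χ i := by simp [χ]
  have htwice (p : PairIdx n) : χ p.1.1 * χ p.1.2 + χ p.1.2 * χ p.1.1 =
      2 * (χ p.1.1 * χ p.1.2) := by ring
  simp only [htwice, hsq, ← Finset.mul_sum, ← Finset.sum_mul, hsum] at h
  have heven : Even (∑ p : PairIdx n, χ p.1.1 * χ p.1.2) := by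
    obtain ⟨q, hq⟩ : ∃ q, X.card = 4 * q + 1 := ⟨X.card / 4, by omega⟩
    rw [hq] at h
    exact ⟨q * (4 * q + 1), by linarith⟩
  rw [eMap_apply_eq, ← (ZMod.natCast_eq_zero_iff_even).2 heven, Nat.cast_sum]
  refine Finset.sum_congr rfl fun p _ => ?_
  simp only [cliqueVec, χ]
  split_ifs <;> simp_all

/-- For `n ≥ 4`, `2 ≤ k ≤ n - 2` and `k ≡ 1 (mod 4)`, the span `H_k` of the `k`-clique
vectors equals `ker(∂) ∩ ker(e)`: edge-sets of even size in which every vertex has even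
degree. -/
theorem Hk_eq_ker_deg_inter_ker_e (n k : ℕ) (hn : 4 ≤ n) (hk2 : 2 ≤ k) (hkn : k ≤ n - 2)
    (hmod : k % 4 = 1) :
    Hk n k = LinearMap.ker (dMap n) ⊓ LinearMap.ker (eMap n) := by
  apply le_antisymm
  · rw [Hk, Submodule.span_le]
    rintro _ ⟨X, rfl, rfl⟩
    exact ⟨dMap_cliqueVec n X (Nat.odd_iff.2 (by omega)), eMap_cliqueVec n X hmod⟩
  · rintro F ⟨hd, he⟩
    exact mem_Hk_of_even n k hn hk2 hkn F hd he
end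

section
/- Let n ≥ 4, 2 ≤ k ≤ n − 2, and m = C(n,2). Then the F_2-dimension of H_k, the span of the clique vectors {v_X : |X| = k}, equals: m if k ≡ 2 (mod 4); m − 1 if k ≡ 0 (mod 4); m − n + 1 if k ≡ 3 (mod 4); and m − n if k ≡ 1 (mod 4). -/
open scoped BigOperators

/-- The strictly upper triangular extension of `g` to all ordered pairs. -/
def upperExt {n : ℕ} (g : PairIdx n → ZMod 2) (x y : Fin n) : ZMod 2 :=
  if h : x < y then g ⟨(x, y), h⟩ else 0

/-- The symmetric extension of `g` to all ordered pairs, zero on the diagonal. -/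
def symExt {n : ℕ} (g : PairIdx n → ZMod 2) (x y : Fin n) : ZMod 2 :=
  upperExt g x y + upperExt g y x

/-- The sum of the values of `g` over all pairs inside `X`. -/
def cliqueSum {n : ℕ} (g : PairIdx n → ZMod 2) (X : Finset (Fin n)) : ZMod 2 :=
  ∑ x ∈ X, ∑ y ∈ X, upperExt g x y

lemma sum_cliqueVec_mul {n : ℕ} (g : PairIdx n → ZMod 2) (X : Finset (Fin n)) :
    ∑ p, cliqueVec n X p * g p = cliqueSum g X := by
  have h1 : ∀ p : PairIdx n, cliqueVec n X p * g p =
      if p.1.1 ∈ X ∧ p.1.2 ∈ X then upperExt g p.1.1 p.1.2 else 0 := by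
    intro p
    have hp : p.1.1 < p.1.2 := p.2
    have hg : upperExt g p.1.1 p.1.2 = g p := by
      unfold upperExt
      rw [dif_pos hp]
      rfl
    rw [hg]
    unfold cliqueVec
    split_ifs <;> simp
  refine (Finset.sum_congr rfl fun p _ => h1 p).trans ?_
  have h2 := Finset.sum_subtype (F := inferInstanceAs (Fintype (PairIdx n)))
    (Finset.univ.filter fun q : Fin n × Fin n => q.1 < q.2)
    (p := fun q : Fin n × Fin n => q.1 < q.2) (by simp)
    (fun q => if q.1 ∈ X ∧ q.2 ∈ X then upperExt g q.1 q.2 else 0)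
  refine h2.symm.trans ?_
  unfold cliqueSum
  rw [← Finset.sum_product', Finset.sum_filter, ← Finset.sum_filter_add_sum_filter_not
    Finset.univ (fun q : Fin n × Fin n => q.1 ∈ X ∧ q.2 ∈ X), add_eq_left.mpr]
  · refine Finset.sum_congr (by ext; simp) fun q hq => ?_
    rw [Finset.mem_product] at hq
    rw [if_pos hq]
    unfold upperExt
    split_ifs <;> rfl
  · refine Finset.sum_eq_zero fun q hq => ?_
    rw [Finset.mem_filter] at hq
    simp [hq.2]

lemma cliqueSum_insert {n : ℕ} (g : PairIdx n → ZMod 2) {a : Fin n} {Y : Finset (Fin n)}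
    (ha : a ∉ Y) : cliqueSum g (insert a Y) = cliqueSum g Y + ∑ y ∈ Y, symExt g a y := by
  have h0 : upperExt g a a = 0 := by simp [upperExt]
  simp only [cliqueSum, symExt, Finset.sum_insert ha, Finset.sum_add_distrib, h0]
  ring

lemma symExt_comm {n : ℕ} (g : PairIdx n → ZMod 2) (x y : Fin n) :
    symExt g x y = symExt g y x := add_comm _ _

lemma symExt_of_lt {n : ℕ} (g : PairIdx n → ZMod 2) {x y : Fin n} (h : x < y) :
    symExt g x y = g ⟨(x, y), h⟩ := by
  simp [symExt, upperExt, h, h.not_gt]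

/-- The edge function `{x, y} ↦ f x + f y + c`, linear in the pair `(f, c)`. -/
def affineEdge (n : ℕ) : ((Fin n → ZMod 2) × ZMod 2) →ₗ[ZMod 2] (PairIdx n → ZMod 2) where
  toFun u p := u.1 p.1.1 + u.1 p.1.2 + u.2
  map_add' u v := by
    ext p
    simp only [Prod.fst_add, Prod.snd_add, Pi.add_apply]
    ring
  map_smul' r u := by
    ext p
    simp only [Prod.smul_fst, Prod.smul_snd, Pi.smul_apply, smul_eq_mul, RingHom.id_apply]
    ring

lemma symExt_affineEdge {n : ℕ} (f : Fin n → ZMod 2) (c : ZMod 2) {x y : Fin n} (h : x ≠ y) :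
    symExt (affineEdge n (f, c)) x y = f x + f y + c := by
  rcases lt_or_gt_of_ne h with h | h
  · rw [symExt_of_lt _ h]
    rfl
  · rw [symExt_comm, symExt_of_lt _ h, add_comm (f x)]
    rfl

lemma cliqueSum_affineEdge {n : ℕ} (f : Fin n → ZMod 2) (c : ZMod 2) (X : Finset (Fin n)) :
    cliqueSum (affineEdge n (f, c)) X =
      ((X.card : ZMod 2) + 1) * ∑ x ∈ X, f x + (X.card.choose 2 : ZMod 2) * c := by
  induction X using Finset.induction_on with
  | empty => simp [cliqueSum]
  | insert a Y ha ih =>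
    have h2 : (2 : ZMod 2) = 0 := rfl
    rw [cliqueSum_insert _ ha, ih, Finset.sum_congr rfl fun y hy =>
      symExt_affineEdge f c (ne_of_mem_of_not_mem hy ha).symm, Finset.card_insert_of_notMem ha,
      Finset.sum_insert ha, Nat.choose_succ_succ' _ 1]
    simp only [Finset.sum_add_distrib, Finset.sum_const, nsmul_eq_mul, Nat.choose_one_right]
    push_cast
    linear_combination (-f a) * h2

/-- The edge functions whose sum over every `k`-clique vanishes. -/
def cliqueAnn (n k : ℕ) : Submodule (ZMod 2) (PairIdx n → ZMod 2) :=
  LinearMap.ker (Matrix.mulVecLin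
    (Matrix.of fun (X : {X : Finset (Fin n) // X.card = k}) => cliqueVec n X.1))

lemma mem_cliqueAnn {n k : ℕ} {g : PairIdx n → ZMod 2} :
    g ∈ cliqueAnn n k ↔ ∀ X : Finset (Fin n), X.card = k → cliqueSum g X = 0 := by
  simp only [cliqueAnn, LinearMap.mem_ker, Matrix.mulVecLin_apply, funext_iff, Subtype.forall,
    Matrix.mulVec, dotProduct, Matrix.of_apply, sum_cliqueVec_mul, Pi.zero_apply]

lemma card_pairIdx (n : ℕ) : Fintype.card (PairIdx n) = n.choose 2 := by
  let e : PairIdx n ≃ Σ y : Fin n, {x // x ∈ Finset.Iio y} :=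
    { toFun p := ⟨p.1.2, p.1.1, Finset.mem_Iio.mpr p.2⟩
      invFun q := ⟨(q.2.1, q.1), Finset.mem_Iio.mp q.2.2⟩
      left_inv _ := rfl
      right_inv _ := rfl }
  rw [Fintype.card_congr e, Fintype.card_sigma]
  simp only [Fintype.card_coe, Fin.card_Iio]
  rw [Fin.sum_univ_eq_sum_range fun i => i, Finset.sum_range_id, Nat.choose_two_right]

lemma finrank_Hk_add_finrank_cliqueAnn (n k : ℕ) :
    Module.finrank (ZMod 2) (Hk n k) + Module.finrank (ZMod 2) (cliqueAnn n k) =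
      n.choose 2 := by
  set M : Matrix {X : Finset (Fin n) // X.card = k} (PairIdx n) (ZMod 2) :=
    Matrix.of fun X => cliqueVec n X.1
  have h1 : Hk n k = Submodule.span (ZMod 2) (Set.range M.row) := by
    unfold Hk
    congr 1
    ext v
    exact ⟨fun ⟨X, hX, hv⟩ => ⟨⟨X, hX⟩, hv⟩, fun ⟨X, hv⟩ => ⟨X.1, X.2, hv⟩⟩
  have h2 := LinearMap.finrank_range_add_finrank_ker M.mulVecLin
  rw [Module.finrank_fintype_fun_eq_card, card_pairIdx] at h2
  rw [h1, ← Matrix.rank_eq_finrank_span_row]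
  exact h2

lemma exists_disjoint_card {n : ℕ} (S : Finset (Fin n)) {r : ℕ} (h : S.card + r ≤ n) :
    ∃ Z : Finset (Fin n), Disjoint Z S ∧ Z.card = r := by
  have hc : r ≤ Sᶜ.card := by
    rw [Finset.card_compl, Fintype.card_fin]
    omega
  obtain ⟨Z, hZ, hr⟩ := Finset.exists_subset_card_eq hc
  exact ⟨Z, Finset.disjoint_left.mpr fun x hx => Finset.mem_compl.mp (hZ hx), hr⟩

lemma sum_symExt_eq_of_mem_cliqueAnn {n k : ℕ} {g : PairIdx n → ZMod 2}
    (hg : g ∈ cliqueAnn n k) {a b : Fin n} {Y : Finset (Fin n)} (hY : Y.card + 1 = k)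
    (ha : a ∉ Y) (hb : b ∉ Y) : ∑ y ∈ Y, symExt g a y = ∑ y ∈ Y, symExt g b y := by
  rw [mem_cliqueAnn] at hg
  have h1 := hg (insert a Y) (by rw [Finset.card_insert_of_notMem ha, hY])
  have h2 := hg (insert b Y) (by rw [Finset.card_insert_of_notMem hb, hY])
  rw [cliqueSum_insert _ ha] at h1
  rw [cliqueSum_insert _ hb] at h2
  exact add_left_cancel (h1.trans h2.symm)

/-- Functions annihilating all `k`-cliques are even on all 4-cycles. -/
lemma symExt_four_cycle {n k : ℕ} (hk2 : 2 ≤ k) (hkn : k + 2 ≤ n) {g : PairIdx n → ZMod 2}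
    (hg : g ∈ cliqueAnn n k) {a b y z : Fin n} (hay : a ≠ y) (haz : a ≠ z) (hby : b ≠ y)
    (hbz : b ≠ z) : symExt g a y + symExt g b y = symExt g a z + symExt g b z := by
  obtain ⟨Z, hZ, hr⟩ := exists_disjoint_card {a, b, y, z} (r := k - 2)
    (by have := Finset.card_le_four (a := a) (b := b) (c := y) (d := z); omega)
  simp only [Finset.disjoint_insert_right, Finset.disjoint_singleton_right] at hZ
  obtain ⟨ha, hb, hy, hz⟩ := hZ
  have key : ∀ w, w ∉ Z → a ≠ w → b ≠ w → symExt g a w + ∑ y ∈ Z, symExt g a y =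
      symExt g b w + ∑ y ∈ Z, symExt g b y := by
    intro w hw haw hbw
    rw [← Finset.sum_insert hw, ← Finset.sum_insert hw]
    refine sum_symExt_eq_of_mem_cliqueAnn hg ?_ (by simp [ha, haw]) (by simp [hb, hbw])
    rw [Finset.card_insert_of_notMem hw]
    omega
  have h2 : (2 : ZMod 2) = 0 := rfl
  linear_combination key y hy hay hby - key z hz haz hbz +
    (symExt g b y - symExt g b z) * h2

lemma exists_affineEdge_eq {n k : ℕ} (hk2 : 2 ≤ k) (hkn : k + 2 ≤ n) {g : PairIdx n → ZMod 2}
    (hg : g ∈ cliqueAnn n k) : ∃ f c, affineEdge n (f, c) = g := by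
  obtain ⟨m, rfl⟩ : ∃ m, n = m + 3 := ⟨n - 3, by omega⟩
  have h2 : ∀ t : ZMod 2, t + t = 0 := by decide
  set s := symExt g with hs
  have hcomm : ∀ x y, s x y = s y x := symExt_comm g
  set T : Fin (m + 3) → Fin (m + 3) → ZMod 2 := fun x y => s x y + s 0 x + s 0 y with hT
  have hTcomm : ∀ x y, T x y = T y x := by
    intro x y
    simp only [hT]
    rw [hcomm x y]
    ring
  have hTstep : ∀ x y z, x ≠ y → x ≠ z → y ≠ 0 → z ≠ 0 → T x y = T x z := by
    intro x y z hxy hxz hy hz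
    have := symExt_four_cycle hk2 hkn hg hxy hxz hy.symm hz.symm
    simp only [hT]
    linear_combination this
  have h10 : (1 : Fin (m + 3)) ≠ 0 := by simp
  have h2lt : 2 % (m + 3) = 2 := Nat.mod_eq_of_lt (by omega)
  have h20 : (2 : Fin (m + 3)) ≠ 0 := by simp [Fin.ext_iff, h2lt]
  have h12 : (1 : Fin (m + 3)) ≠ 2 := by simp [Fin.ext_iff, h2lt]
  have hTconst : ∀ x y, x ≠ y → x ≠ 0 → y ≠ 0 → T x y = T 1 2 := by
    intro x y hxy hx hy
    by_cases hx1 : x = 1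
    · subst hx1
      exact hTstep _ _ _ hxy h12 hy h20
    · rw [hTstep x y 1 hxy hx1 hy h10, hTcomm, hTstep 1 x 2 (Ne.symm hx1) h12 hx h20]
  refine ⟨fun x => if x = 0 then 0 else s 0 x + T 1 2, T 1 2, ?_⟩
  funext p
  obtain ⟨⟨x, y⟩, hp⟩ := p
  have hxy : x < y := hp
  have hy : y ≠ 0 := ((Fin.zero_le x).trans_lt hxy).ne'
  rw [← symExt_of_lt g hxy, ← symExt_of_lt (affineEdge _ _) hxy,
    symExt_affineEdge _ _ hxy.ne, ← hs]
  simp only [hy, if_false]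
  by_cases hx : x = 0
  · subst hx
    simp only [if_true]
    linear_combination h2 (T 1 2)
  · simp only [hx, if_false]
    have := hTconst x y hxy.ne hx hy
    simp only [hT] at this ⊢
    linear_combination h2 (s 0 x) + h2 (s 0 y) + h2 (s 1 2 + s 0 1 + s 0 2) - this

lemma affineEdge_eq_zero_iff {n : ℕ} (hn : 3 ≤ n) {f : Fin n → ZMod 2} {c : ZMod 2} :
    affineEdge n (f, c) = 0 ↔ c = 0 ∧ ∃ t, f = fun _ => t := by
  have h2 : ∀ t : ZMod 2, t + t = 0 := by decide
  constructor
  · intro h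
    have hxy : ∀ x y, x ≠ y → f x + f y + c = 0 := by
      intro x y hne
      have h0 : ∀ x y, upperExt (0 : PairIdx n → ZMod 2) x y = 0 :=
        fun _ _ => dite_eq_right_iff.mpr fun _ => rfl
      rw [← symExt_affineEdge f c hne, h, symExt, h0, h0, add_zero]
    let x₀ : Fin n := ⟨0, by omega⟩
    let x₁ : Fin n := ⟨1, by omega⟩
    let x₂ : Fin n := ⟨2, by omega⟩
    have h01 := hxy x₀ x₁ (by simp [x₀, x₁])
    have h02 := hxy x₀ x₂ (by simp [x₀, x₂])
    have h12 := hxy x₁ x₂ (by simp [x₁, x₂])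
    have hc : c = 0 := by
      linear_combination h01 + h02 + h12 - h2 (f x₀) - h2 (f x₁) - h2 (f x₂) - h2 c
    refine ⟨hc, f x₀, funext fun x => ?_⟩
    by_cases hx : x = x₀
    · rw [hx]
    · linear_combination hxy x x₀ hx - hc - h2 (f x₀)
  · rintro ⟨rfl, t, rfl⟩
    funext p
    simp [affineEdge, h2]

lemma finrank_range_affineEdge {n : ℕ} (hn : 3 ≤ n) :
    Module.finrank (ZMod 2) (LinearMap.range (affineEdge n)) = n := by
  have hker : LinearMap.ker (affineEdge n) = Submodule.span (ZMod 2) {((fun _ => 1), 0)} := by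
    ext ⟨f, c⟩
    rw [LinearMap.mem_ker, affineEdge_eq_zero_iff hn, Submodule.mem_span_singleton]
    simp only [Prod.smul_mk, smul_zero, Prod.mk.injEq, eq_comm (a := c),
      eq_comm (a := f), and_comm (b := 0 = c)]
    simp [Pi.smul_def]
  have h := LinearMap.finrank_range_add_finrank_ker (affineEdge n)
  rw [hker, finrank_span_singleton] at h
  · simpa using h
  · intro h0
    exact one_ne_zero (congrFun (congrArg Prod.fst h0) ⟨0, by omega⟩)

/-- The restriction of `affineEdge` to zero constant term. -/
def sumEdge (n : ℕ) : (Fin n → ZMod 2) →ₗ[ZMod 2] (PairIdx n → ZMod 2) :=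
  affineEdge n ∘ₗ LinearMap.inl (ZMod 2) (Fin n → ZMod 2) (ZMod 2)

lemma sumEdge_apply {n : ℕ} (f : Fin n → ZMod 2) : sumEdge n f = affineEdge n (f, 0) := rfl

lemma finrank_range_sumEdge {n : ℕ} (hn : 3 ≤ n) :
    Module.finrank (ZMod 2) (LinearMap.range (sumEdge n)) + 1 = n := by
  have hker : LinearMap.ker (sumEdge n) = Submodule.span (ZMod 2) {fun _ => 1} := by
    ext f
    rw [LinearMap.mem_ker, sumEdge_apply, affineEdge_eq_zero_iff hn,
      Submodule.mem_span_singleton]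
    simp [Pi.smul_def, eq_comm (a := f)]
  have h := LinearMap.finrank_range_add_finrank_ker (sumEdge n)
  rw [hker, finrank_span_singleton] at h
  · simpa using h
  · intro h0
    exact one_ne_zero (congrFun h0 ⟨0, by omega⟩)

lemma natCast_mod_four (k : ℕ) : ((k % 4 : ℕ) : ZMod 2) = k := by
  have h : Function.Periodic (fun k : ℕ => (k : ZMod 2)) 4 := by
    intro k
    have h4 : (4 : ZMod 2) = 0 := rfl
    simp [h4]
  exact h.map_mod_nat k

lemma choose_two_mod_four (k : ℕ) : (((k % 4).choose 2 : ℕ) : ZMod 2) = k.choose 2 := by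
  have h : Function.Periodic (fun k : ℕ => (k.choose 2 : ZMod 2)) 4 := by
    intro k
    have h2 : (2 : ZMod 2) = 0 := rfl
    simp only [Nat.choose_succ_succ' _ 1, Nat.choose_one_right]
    push_cast
    linear_combination (2 * (k : ZMod 2) + 3) * h2
  exact h.map_mod_nat k

lemma exists_const_of_mem_cliqueAnn {n k : ℕ} (hk2 : 2 ≤ k) (hkn : k + 2 ≤ n)
    (hk : (k : ZMod 2) = 0) {g : PairIdx n → ZMod 2} (hg : g ∈ cliqueAnn n k) :
    ∃ c, affineEdge n (0, c) = g := by
  obtain ⟨f, c, rfl⟩ := exists_affineEdge_eq hk2 hkn hg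
  have hf : ∀ a b, f a = f b := by
    intro a b
    obtain ⟨Y, hY, hr⟩ := exists_disjoint_card {a, b} (r := k - 1)
      (by have := Finset.card_le_two (a := a) (b := b); omega)
    simp only [Finset.disjoint_insert_right, Finset.disjoint_singleton_right] at hY
    rw [mem_cliqueAnn] at hg
    have key : ∀ x, x ∉ Y → f x + ∑ y ∈ Y, f y + (k.choose 2 : ZMod 2) * c = 0 := by
      intro x hx
      have hcard : (insert x Y).card = k := by
        rw [Finset.card_insert_of_notMem hx]
        omega
      have := hg _ hcard
      rwa [cliqueSum_affineEdge, hcard, hk, zero_add, one_mul, Finset.sum_insert hx] at this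
    linear_combination key a hY.1 - key b hY.2
  have h2 : ∀ t : ZMod 2, t + t = 0 := by decide
  refine ⟨c, funext fun p => ?_⟩
  simp [affineEdge, hf p.1.1 p.1.2, h2]

lemma affineEdge_mem_cliqueAnn_iff {n k : ℕ} (hkn : k ≤ n) {f : Fin n → ZMod 2} {c : ZMod 2}
    (hf : ((k : ZMod 2) + 1) = 0 ∨ f = 0) :
    affineEdge n (f, c) ∈ cliqueAnn n k ↔ (k.choose 2 : ZMod 2) * c = 0 := by
  have hsum : ∀ X : Finset (Fin n), X.card = k →
      cliqueSum (affineEdge n (f, c)) X = (k.choose 2 : ZMod 2) * c := by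
    intro X hX
    rw [cliqueSum_affineEdge, hX]
    rcases hf with hf | rfl
    · rw [hf, zero_mul, zero_add]
    · simp
  rw [mem_cliqueAnn]
  constructor
  · intro h
    obtain ⟨X, -, hX⟩ := exists_disjoint_card (∅ : Finset (Fin n)) (r := k) (by simpa)
    rw [← hsum X hX, h X hX]
  · intro h X hX
    rw [hsum X hX, h]

/-- For `n ≥ 4`, `2 ≤ k ≤ n - 2` and `m = C(n,2)`, the `F_2`-dimension of `H_k` equals
`m` if `k ≡ 2 (mod 4)`, `m - 1` if `k ≡ 0 (mod 4)`, `m - n + 1` if `k ≡ 3 (mod 4)`, and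
`m - n` if `k ≡ 1 (mod 4)`. -/
theorem Hk_finrank (n k : ℕ) (hn : 4 ≤ n) (hk2 : 2 ≤ k) (hkn : k ≤ n - 2) :
    Module.finrank (ZMod 2) (Hk n k) =
      if k % 4 = 2 then n.choose 2
      else if k % 4 = 0 then n.choose 2 - 1
      else if k % 4 = 3 then n.choose 2 - n + 1
      else n.choose 2 - n := by
  have hkn' : k + 2 ≤ n := by omega
  have hle : k ≤ n := by omega
  have hadd := finrank_Hk_add_finrank_cliqueAnn n k
  have hcast := natCast_mod_four k
  have hchoose := choose_two_mod_four k
  have h02 : ((2 : ℕ) : ZMod 2) = 0 := rfl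
  have h31 : ((3 : ℕ) : ZMod 2) = 1 := rfl
  have h11 : (1 : ZMod 2) + 1 = 0 := rfl
  have hlt : k % 4 < 4 := Nat.mod_lt _ (by norm_num)
  have hcases : k % 4 = 2 ∨ k % 4 = 0 ∨ k % 4 = 3 ∨ k % 4 = 1 := by omega
  rcases hcases with h | h | h | h <;> rw [h] at hcast hchoose
  · have hann : cliqueAnn n k = ⊥ := by
      refine (Submodule.eq_bot_iff _).mpr fun g hg => ?_
      obtain ⟨c, rfl⟩ := exists_const_of_mem_cliqueAnn hk2 hkn' (hcast.symm.trans h02) hg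
      rw [affineEdge_mem_cliqueAnn_iff hle (Or.inr rfl), ← hchoose] at hg
      have hc : c = 0 := by simpa using hg
      rw [hc]
      exact map_zero _
    rw [hann, finrank_bot] at hadd
    simpa [h] using hadd
  · have hann : cliqueAnn n k = Submodule.span (ZMod 2) {affineEdge n (0, 1)} := by
      ext g
      rw [Submodule.mem_span_singleton]
      constructor
      · intro hg
        obtain ⟨c, rfl⟩ := exists_const_of_mem_cliqueAnn hk2 hkn' (by simpa using hcast.symm) hg
        exact ⟨c, by rw [← map_smul]; simp⟩
      · rintro ⟨c, rfl⟩
        refine Submodule.smul_mem _ _ ?_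
        rw [affineEdge_mem_cliqueAnn_iff hle (Or.inr rfl), ← hchoose]
        simp
    rw [hann, finrank_span_singleton] at hadd
    · simp only [h]
      norm_num
      omega
    · rw [Ne, affineEdge_eq_zero_iff (by omega)]
      simp
  · have hk1 : (k : ZMod 2) + 1 = 0 := by rw [← hcast, h31, h11]
    have hc1 : (k.choose 2 : ZMod 2) = 1 := by rw [← hchoose]; rfl
    have hann : cliqueAnn n k = LinearMap.range (sumEdge n) := by
      ext g
      constructor
      · intro hg
        obtain ⟨f, c, rfl⟩ := exists_affineEdge_eq hk2 hkn' hg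
        rw [affineEdge_mem_cliqueAnn_iff hle (Or.inl hk1), hc1, one_mul] at hg
        exact ⟨f, by rw [sumEdge_apply, hg]⟩
      · rintro ⟨f, rfl⟩
        rw [sumEdge_apply, affineEdge_mem_cliqueAnn_iff hle (Or.inl hk1), mul_zero]
    have hr := finrank_range_sumEdge (n := n) (by omega)
    have hm : n ≤ n.choose 2 := by
      obtain ⟨m, rfl⟩ : ∃ m, n = m + 3 := ⟨n - 3, by omega⟩
      simp only [Nat.choose_succ_succ' _ 1, Nat.choose_one_right]
      omega
    rw [hann] at hadd
    simp only [h]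
    norm_num
    omega
  · have hk1 : (k : ZMod 2) + 1 = 0 := by rw [← hcast, Nat.cast_one, h11]
    have hc0 : (k.choose 2 : ZMod 2) = 0 := by rw [← hchoose]; rfl
    have hann : cliqueAnn n k = LinearMap.range (affineEdge n) := by
      ext g
      constructor
      · intro hg
        obtain ⟨f, c, rfl⟩ := exists_affineEdge_eq hk2 hkn' hg
        exact ⟨_, rfl⟩
      · rintro ⟨⟨f, c⟩, rfl⟩
        rw [affineEdge_mem_cliqueAnn_iff hle (Or.inl hk1), hc0, zero_mul]
    rw [hann, finrank_range_affineEdge (by omega)] at hadd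
    simp only [h]
    norm_num
    omega
end

section
/- (Wilson's rank formula for t = 2.) Let 2 ≤ k ≤ n − 2 and let W_{2,k}(n) be the 0/1 inclusion matrix with rows indexed by 2-subsets and columns by k-subsets of [n], whose entry is 1 iff the 2-subset is contained in the k-subset. Then rank_{F_2} W_{2,k}(n) = Σ_j (C(n,j) − C(n,j−1)), the sum over those j ∈ {0,1,2} for which the binomial coefficient C(k−j, 2−j) is odd, with the convention C(n,−1) = 0. -/
open scoped BigOperators

/-- The inclusion matrix `W_{2,k}(n)` over `F_2`: rows indexed by `2`-subsets and columns
by `k`-subsets of `[n]`, with entry `1` iff the `2`-subset is contained in the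
`k`-subset. -/
def inclusionMatrix (n k : ℕ) :
    Matrix {S : Finset (Fin n) // S.card = 2} {T : Finset (Fin n) // T.card = k}
      (ZMod 2) :=
  Matrix.of fun S T => if S.1 ⊆ T.1 then 1 else 0

/-- The sum of an edge weight `F` over all `2`-subsets of `T`. -/
def pairSum {n : ℕ} (F : Finset (Fin n) → ZMod 2) (T : Finset (Fin n)) : ZMod 2 :=
  ∑ S ∈ T.powersetCard 2, F S

theorem pairSum_insert {n : ℕ} (F : Finset (Fin n) → ZMod 2) {x : Fin n}
    {T : Finset (Fin n)} (hx : x ∉ T) :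
    pairSum F (insert x T) = pairSum F T + ∑ y ∈ T, F {x, y} := by
  unfold pairSum
  rw [Finset.powersetCard_succ_insert hx, Finset.sum_union, Finset.sum_image]
  · rw [Finset.powersetCard_one, Finset.sum_map]
    rfl
  · intro A hA B hB h
    have hA' : x ∉ A := fun h' => hx ((Finset.mem_powersetCard.1 hA).1 h')
    have hB' : x ∉ B := fun h' => hx ((Finset.mem_powersetCard.1 hB).1 h')
    rw [← Finset.erase_insert hA', ← Finset.erase_insert hB']
    exact congrArg (fun s => Finset.erase s x) h
  · rw [Finset.disjoint_left]
    intro A hA hB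
    obtain ⟨B, -, rfl⟩ := Finset.mem_image.1 hB
    exact hx ((Finset.mem_powersetCard.1 hA).1 (Finset.mem_insert_self x B))

theorem zmod_two_eq_zero : (2 : ZMod 2) = 0 := rfl

/-- The pair sum of the weight `c + a x + a y`. -/
theorem pairSum_add_sum {n : ℕ} (c : ZMod 2) (a : Fin n → ZMod 2) (T : Finset (Fin n)) :
    pairSum (fun S => c + ∑ i ∈ S, a i) T =
      c * (T.card.choose 2 : ℕ) + (T.card + 1) * ∑ i ∈ T, a i := by
  induction T using Finset.induction_on with
  | empty =>
    have h : (∅ : Finset (Fin n)).powersetCard 2 = ∅ :=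
      Finset.powersetCard_eq_empty.2 (by simp)
    simp [pairSum, h]
  | insert x T hx ih =>
    have h : ∑ y ∈ T, (c + ∑ i ∈ ({x, y} : Finset (Fin n)), a i) =
        T.card * c + T.card * a x + ∑ y ∈ T, a y := by
      have h' : ∀ y ∈ T, (c + ∑ i ∈ ({x, y} : Finset (Fin n)), a i) = c + a x + a y := by
        intro y hy
        rw [Finset.sum_pair (by rintro rfl; exact hx hy), add_assoc]
      rw [Finset.sum_congr rfl h', Finset.sum_add_distrib]
      simp
    rw [pairSum_insert _ hx, ih, h, Finset.card_insert_of_notMem hx, Finset.sum_insert hx,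
      Nat.choose_succ_succ' T.card 1, Nat.choose_one_right]
    push_cast
    linear_combination (-a x) * zmod_two_eq_zero

/-- There is a set of any small enough size avoiding a given finite set. -/
theorem exists_card_eq_disjoint {n r : ℕ} (A : Finset (Fin n)) (h : r + A.card ≤ n) :
    ∃ R : Finset (Fin n), R.card = r ∧ Disjoint R A := by
  have hc : r ≤ Aᶜ.card := by
    rw [Finset.card_compl, Fintype.card_fin]
    omega
  obtain ⟨R, hR, hr⟩ := Finset.exists_subset_card_eq hc
  exact ⟨R, hr, Finset.disjoint_left.2 fun x hx => Finset.mem_compl.1 (hR hx)⟩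

theorem four_cycle_eq_zero {n k : ℕ} (hk2 : 2 ≤ k) (hkn : k + 2 ≤ n)
    {F : Finset (Fin n) → ZMod 2} (hF : ∀ T : Finset (Fin n), T.card = k → pairSum F T = 0)
    {x y s t : Fin n} (hxy : x ≠ y) (hxs : x ≠ s) (hxt : x ≠ t) (hys : y ≠ s) (hyt : y ≠ t)
    (hst : s ≠ t) : F {x, s} + F {y, s} + F {x, t} + F {y, t} = 0 := by
  have hcard : ({x, y, s, t} : Finset (Fin n)).card = 4 := by
    simp [Finset.card_insert_of_notMem, *]
  obtain ⟨R, hR, hd⟩ := exists_card_eq_disjoint (r := k - 2) {x, y, s, t} (by omega)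
  have hnot : ∀ z ∈ ({x, y, s, t} : Finset (Fin n)), z ∉ R :=
    fun z hz hzR => Finset.disjoint_left.1 hd hzR hz
  have hx := hnot x (by simp)
  have hy := hnot y (by simp)
  have hs := hnot s (by simp)
  have ht := hnot t (by simp)
  have key : ∀ u v : Fin n, u ∉ R → v ∉ R → u ≠ v →
      pairSum F R + ∑ r ∈ R, F {v, r} + (F {u, v} + ∑ r ∈ R, F {u, r}) = 0 := by
    intro u v hu hv huv
    have hu' : u ∉ insert v R := by simp [huv, hu]
    rw [← hF (insert u (insert v R)), pairSum_insert F hu', pairSum_insert F hv,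
      Finset.sum_insert hv]
    rw [Finset.card_insert_of_notMem hu', Finset.card_insert_of_notMem hv]
    omega
  linear_combination key x s hx hs hxs + key y s hy hs hys + key x t hx ht hxt +
    key y t hy ht hyt - (2 * pairSum F R + ∑ r ∈ R, F {s, r} + ∑ r ∈ R, F {t, r} +
      ∑ r ∈ R, F {x, r} + ∑ r ∈ R, F {y, r}) * zmod_two_eq_zero

/-- A weight all of whose `k`-subsets have zero pair sum has the form `c + a x + a y`. -/
theorem exists_eq_add_of_pairSum_eq_zero {m k : ℕ} (hk2 : 2 ≤ k) (hkn : k + 2 ≤ m + 1)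
    {F : Finset (Fin (m + 1)) → ZMod 2}
    (hF : ∀ T : Finset (Fin (m + 1)), T.card = k → pairSum F T = 0) :
    ∃ (c : ZMod 2) (b : Fin m → ZMod 2), ∀ x y : Fin (m + 1), x ≠ y →
      F {x, y} = c + (Fin.cons 0 b : Fin (m + 1) → ZMod 2) x +
        (Fin.cons 0 b : Fin (m + 1) → ZMod 2) y := by
  let t : Fin m → Fin m → ZMod 2 := fun i j =>
    F {0, i.succ} + F {0, j.succ} + F {i.succ, j.succ}
  have hsymm : ∀ i j, t i j = t j i := by
    intro i j
    simp only [t]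
    rw [Finset.pair_comm i.succ j.succ]
    ring
  have hrow : ∀ i j l, i ≠ j → i ≠ l → t i j = t i l := by
    intro i j l hij hil
    by_cases hjl : j = l
    · rw [hjl]
    have h := four_cycle_eq_zero hk2 hkn hF (x := 0) (y := i.succ) (s := j.succ) (t := l.succ)
      (Fin.succ_ne_zero _).symm (Fin.succ_ne_zero _).symm (Fin.succ_ne_zero _).symm
      (by simpa using hij) (by simpa using hil) (by simpa using hjl)
    simp only [t]
    linear_combination h - (F {0, l.succ} + F {i.succ, l.succ}) * zmod_two_eq_zero
  let p : Fin m := ⟨0, by omega⟩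
  let q : Fin m := ⟨1, by omega⟩
  have hpq : p ≠ q := by simp [p, q]
  have hconst : ∀ i j, i ≠ j → t i j = t p q := by
    intro i j hij
    by_cases hi : i = p
    · subst hi
      exact hrow _ _ _ hij hpq
    · rw [hrow i j p hij hi, hsymm]
      exact hrow _ _ _ (Ne.symm hi) hpq
  refine ⟨t p q, fun i => F {0, i.succ} + t p q, fun x y => ?_⟩
  refine Fin.cases ?_ (fun i => ?_) x <;> refine Fin.cases ?_ (fun j => ?_) y
  · simp
  · intro _
    simp only [Fin.cons_zero, Fin.cons_succ]
    linear_combination (-t p q) * zmod_two_eq_zero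
  · intro _
    simp only [Fin.cons_zero, Fin.cons_succ]
    rw [Finset.pair_comm]
    linear_combination (-t p q) * zmod_two_eq_zero
  · intro hij
    simp only [Fin.cons_succ]
    have h : F {0, i.succ} + F {0, j.succ} + F {i.succ, j.succ} = t p q :=
      hconst i j fun h => hij (by rw [h])
    linear_combination h - (F {0, i.succ} + F {0, j.succ} + t p q) * zmod_two_eq_zero

/-- The edge weights `c + a x + a y`, normalised by `a 0 = 0`. -/
def weightMap (m : ℕ) : (ZMod 2 × (Fin m → ZMod 2)) →ₗ[ZMod 2]
    ({S : Finset (Fin (m + 1)) // S.card = 2} → ZMod 2) where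
  toFun p S := p.1 + ∑ i ∈ S.1, (Fin.cons 0 p.2 : Fin (m + 1) → ZMod 2) i
  map_add' p q := by
    funext S
    have h : ∀ i, (Fin.cons 0 (p.2 + q.2) : Fin (m + 1) → ZMod 2) i =
        (Fin.cons 0 p.2 : Fin (m + 1) → ZMod 2) i +
          (Fin.cons 0 q.2 : Fin (m + 1) → ZMod 2) i :=
      fun i => by refine Fin.cases ?_ (fun j => ?_) i <;> simp
    simp only [Prod.fst_add, Prod.snd_add, h, Finset.sum_add_distrib, Pi.add_apply]
    ring
  map_smul' r p := by
    funext S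
    have h : ∀ i, (Fin.cons 0 (r • p.2) : Fin (m + 1) → ZMod 2) i =
        r * (Fin.cons 0 p.2 : Fin (m + 1) → ZMod 2) i :=
      fun i => by refine Fin.cases ?_ (fun j => ?_) i <;> simp
    simp only [Prod.smul_fst, Prod.smul_snd, h, ← Finset.mul_sum, Pi.smul_apply, smul_eq_mul,
      RingHom.id_apply]
    ring

theorem weightMap_injective {m : ℕ} (hm : 2 ≤ m) : Function.Injective (weightMap m) := by
  rw [injective_iff_map_eq_zero]
  rintro ⟨c, b⟩ h
  have hval : ∀ x y : Fin (m + 1), x ≠ y → c + ((Fin.cons 0 b : Fin (m + 1) → ZMod 2) x +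
      (Fin.cons 0 b : Fin (m + 1) → ZMod 2) y) = 0 := by
    intro x y hxy
    have := congrFun h ⟨{x, y}, Finset.card_pair hxy⟩
    simp only [weightMap, LinearMap.coe_mk, AddHom.coe_mk, Pi.zero_apply] at this
    rwa [Finset.sum_pair hxy] at this
  have hb : ∀ i, c + b i = 0 := fun i => by
    simpa using hval 0 i.succ (Fin.succ_ne_zero i).symm
  have hc : c = 0 := by
    have h01 := hval (Fin.succ ⟨0, by omega⟩) (Fin.succ ⟨1, by omega⟩) (by simp)
    simp only [Fin.cons_succ] at h01
    linear_combination hb ⟨0, by omega⟩ + hb ⟨1, by omega⟩ - h01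
  subst hc
  simp only [zero_add] at hb
  exact Prod.ext rfl (funext hb)

/-- The left kernel of the inclusion matrix: the weights with all `k`-subset sums zero. -/
theorem mem_ker_transpose_inclusionMatrix {n k : ℕ} (F : Finset (Fin n) → ZMod 2) :
    (fun S : {S : Finset (Fin n) // S.card = 2} => F S.1) ∈
        LinearMap.ker (inclusionMatrix n k).transpose.mulVecLin ↔
      ∀ T : Finset (Fin n), T.card = k → pairSum F T = 0 := by
  have key : ∀ T : {T : Finset (Fin n) // T.card = k},
      (inclusionMatrix n k).transpose.mulVecLin (fun S => F S.1) T = pairSum F T.1 := by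
    intro T
    simp only [Matrix.mulVecLin_apply, Matrix.mulVec, dotProduct, Matrix.transpose_apply,
      inclusionMatrix, Matrix.of_apply, ite_mul, one_mul, zero_mul]
    rw [← Finset.sum_subtype (s := Finset.univ.powersetCard 2) (p := fun S => S.card = 2)
      (by simp [Finset.mem_powersetCard]) (fun S => if S ⊆ T.1 then F S else 0),
      ← Finset.sum_filter]
    refine Finset.sum_congr ?_ fun _ _ => rfl
    ext S
    simp [Finset.mem_powersetCard, and_comm]
  rw [LinearMap.mem_ker, funext_iff]
  simp only [key, Pi.zero_apply, Subtype.forall]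

/-- The parameters whose weight lies in the left kernel of the inclusion matrix. -/
def kernelParams (m k : ℕ) : Submodule (ZMod 2) (ZMod 2 × (Fin m → ZMod 2)) :=
  (LinearMap.ker (inclusionMatrix (m + 1) k).transpose.mulVecLin).comap (weightMap m)

theorem mem_kernelParams {m k : ℕ} {c : ZMod 2} {b : Fin m → ZMod 2} :
    (c, b) ∈ kernelParams m k ↔ ∀ T : Finset (Fin (m + 1)), T.card = k →
      c * (k.choose 2 : ℕ) + (k + 1) * ∑ i ∈ T, (Fin.cons 0 b : Fin (m + 1) → ZMod 2) i = 0 := by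
  refine (mem_ker_transpose_inclusionMatrix
    (fun S => c + ∑ i ∈ S, (Fin.cons 0 b : Fin (m + 1) → ZMod 2) i)).trans ?_
  refine forall_congr' fun T => forall_congr' fun hT => ?_
  rw [pairSum_add_sum, hT]

theorem finrank_ker_eq_finrank_kernelParams {m k : ℕ} (hk2 : 2 ≤ k) (hkn : k + 2 ≤ m + 1) :
    Module.finrank (ZMod 2) (LinearMap.ker (inclusionMatrix (m + 1) k).transpose.mulVecLin) =
      Module.finrank (ZMod 2) (kernelParams m k) := by
  have hle : LinearMap.ker (inclusionMatrix (m + 1) k).transpose.mulVecLin ≤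
      LinearMap.range (weightMap m) := by
    intro f hf
    let F : Finset (Fin (m + 1)) → ZMod 2 := fun S => if h : S.card = 2 then f ⟨S, h⟩ else 0
    have hfF : f = fun S => F S.1 := by
      funext S
      simp [F, S.2]
    rw [hfF, mem_ker_transpose_inclusionMatrix] at hf
    obtain ⟨c, b, h⟩ := exists_eq_add_of_pairSum_eq_zero hk2 hkn hf
    refine ⟨(c, b), ?_⟩
    rw [hfF]
    funext S
    obtain ⟨x, y, hxy, hS⟩ := Finset.card_eq_two.1 S.2
    simp only [weightMap, LinearMap.coe_mk, AddHom.coe_mk]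
    rw [hS, Finset.sum_pair hxy, h x y hxy, add_assoc]
  have hmap : (kernelParams m k).map (weightMap m) =
      LinearMap.ker (inclusionMatrix (m + 1) k).transpose.mulVecLin := by
    rw [kernelParams, Submodule.map_comap_eq, inf_eq_right.2 hle]
  rw [← hmap]
  exact (Submodule.equivMapOfInjective _ (weightMap_injective (by omega)) _).finrank_eq.symm

theorem rank_inclusionMatrix_add_finrank {m k : ℕ} (hk2 : 2 ≤ k) (hkn : k + 2 ≤ m + 1) :
    (inclusionMatrix (m + 1) k).rank + Module.finrank (ZMod 2) (kernelParams m k) =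
      (m + 1).choose 2 := by
  rw [← Matrix.rank_transpose, ← finrank_ker_eq_finrank_kernelParams hk2 hkn, Matrix.rank,
    LinearMap.finrank_range_add_finrank_ker, Module.finrank_fintype_fun_eq_card,
    Fintype.card_finset_len, Fintype.card_fin]

theorem eq_zero_of_mem_kernelParams {m k : ℕ} (hk1 : 1 ≤ k) (hkn : k + 1 ≤ m + 1)
    (hk : (k : ZMod 2) = 0) {c : ZMod 2} {b : Fin m → ZMod 2}
    (h : (c, b) ∈ kernelParams m k) : b = 0 := by
  rw [mem_kernelParams] at h
  funext j
  obtain ⟨R, hR, hd⟩ := exists_card_eq_disjoint (r := k - 1) ({0, j.succ} : Finset (Fin (m + 1)))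
    (by rw [Finset.card_pair (Fin.succ_ne_zero j).symm]; omega)
  have h0 : (0 : Fin (m + 1)) ∉ R := fun hz => Finset.disjoint_left.1 hd hz (by simp)
  have hj : j.succ ∉ R := fun hz => Finset.disjoint_left.1 hd hz (by simp)
  have e0 := h (insert 0 R) (by rw [Finset.card_insert_of_notMem h0]; omega)
  have ej := h (insert j.succ R) (by rw [Finset.card_insert_of_notMem hj]; omega)
  rw [Finset.sum_insert h0, hk, Fin.cons_zero] at e0
  rw [Finset.sum_insert hj, hk, Fin.cons_succ] at ej
  simp only [Pi.zero_apply]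
  linear_combination ej - e0

theorem mem_kernelParams_zero {m k : ℕ} (hkn : k ≤ m + 1) {c : ZMod 2} :
    (c, (0 : Fin m → ZMod 2)) ∈ kernelParams m k ↔ c * (k.choose 2 : ℕ) = 0 := by
  have hz : (Fin.cons 0 (0 : Fin m → ZMod 2) : Fin (m + 1) → ZMod 2) = 0 := by
    funext i
    refine Fin.cases ?_ (fun j => ?_) i <;> simp
  rw [mem_kernelParams, hz]
  simp only [Pi.zero_apply, Finset.sum_const_zero, mul_zero, add_zero]
  refine ⟨fun h => ?_, fun h _ _ => h⟩
  obtain ⟨T, hT, -⟩ := exists_card_eq_disjoint (n := m + 1) (r := k) ∅ (by simpa using hkn)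
  exact h T hT

theorem mem_kernelParams_of_odd {m k : ℕ} (hkn : k ≤ m + 1) (hk : (k : ZMod 2) = 1)
    {c : ZMod 2} {b : Fin m → ZMod 2} :
    (c, b) ∈ kernelParams m k ↔ c * (k.choose 2 : ℕ) = 0 := by
  have h2 : (1 + 1 : ZMod 2) = 0 := rfl
  rw [← mem_kernelParams_zero hkn, mem_kernelParams, mem_kernelParams, hk, h2]
  simp only [zero_mul]

theorem finrank_kernelParams {m k : ℕ} (hk1 : 1 ≤ k) (hkn : k + 1 ≤ m + 1) :
    Module.finrank (ZMod 2) (kernelParams m k) =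
      (if Odd (k.choose 2) then 0 else 1) + (if Odd k then m else 0) := by
  have hodd : ∀ a : ℕ, Odd a → (a : ZMod 2) = 1 := fun a ha =>
    (ZMod.natCast_eq_one_iff_odd).2 ha
  have heven : ∀ a : ℕ, ¬ Odd a → (a : ZMod 2) = 0 := fun a ha =>
    (ZMod.natCast_eq_zero_iff_even).2 (Nat.not_odd_iff_even.1 ha)
  split_ifs with hc hk hk
  · have : kernelParams m k =
        LinearMap.range (LinearMap.inr (ZMod 2) (ZMod 2) (Fin m → ZMod 2)) := by
      ext ⟨c, b⟩
      rw [mem_kernelParams_of_odd (by omega) (hodd _ hk), hodd _ hc]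
      simp [eq_comm]
    rw [this, LinearMap.finrank_range_of_inj LinearMap.inr_injective]
    simp
  · have : kernelParams m k = ⊥ := by
      rw [eq_bot_iff]
      rintro ⟨c, b⟩ h
      obtain rfl := eq_zero_of_mem_kernelParams hk1 hkn (heven _ hk) h
      rw [mem_kernelParams_zero (by omega), hodd _ hc] at h
      simpa using h
    simp [this]
  · have : kernelParams m k = ⊤ := by
      rw [eq_top_iff]
      rintro ⟨c, b⟩ -
      rw [mem_kernelParams_of_odd (by omega) (hodd _ hk), heven _ hc, mul_zero]
    rw [this, finrank_top, Module.finrank_prod, Module.finrank_self, Module.finrank_fin_fun]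
  · have : kernelParams m k =
        LinearMap.range (LinearMap.inl (ZMod 2) (ZMod 2) (Fin m → ZMod 2)) := by
      ext ⟨c, b⟩
      constructor
      · intro h
        obtain rfl := eq_zero_of_mem_kernelParams hk1 hkn (heven _ hk) h
        exact ⟨c, rfl⟩
      · rintro ⟨c', h⟩
        obtain ⟨rfl, rfl⟩ := Prod.ext_iff.1 h
        exact (mem_kernelParams_zero (by omega)).2 (by rw [heven _ hc, mul_zero])
    rw [this, LinearMap.finrank_range_of_inj LinearMap.inl_injective]
    simp

/-- Wilson's rank formula for `t = 2`: for `2 ≤ k ≤ n - 2`,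
`rank_{F_2} W_{2,k}(n) = Σ_j (C(n,j) - C(n,j-1))`, summed over those `j ∈ {0,1,2}` for
which `C(k-j, 2-j)` is odd, with the convention `C(n,-1) = 0`. -/
theorem wilson_rank_formula (n k : ℕ) (hk2 : 2 ≤ k) (hkn : k ≤ n - 2) :
    (inclusionMatrix n k).rank =
      ∑ j ∈ Finset.filter (fun j => Odd ((k - j).choose (2 - j)))
          ({0, 1, 2} : Finset ℕ),
        (n.choose j - (if j = 0 then 0 else n.choose (j - 1))) := by
  obtain ⟨m, rfl⟩ : ∃ m, n = m + 1 := ⟨n - 1, by omega⟩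
  have hr := rank_inclusionMatrix_add_finrank (m := m) hk2 (by omega)
  rw [finrank_kernelParams (by omega) (by omega)] at hr
  have hk : Odd (k - 1) ↔ ¬ Odd k := by
    rw [Nat.odd_iff, Nat.odd_iff]
    omega
  have hle : m + 1 ≤ (m + 1).choose 2 := by
    rw [Nat.choose_two_right, Nat.le_div_iff_mul_le two_pos, Nat.add_sub_cancel]
    exact Nat.mul_le_mul_left _ (by omega)
  rw [Finset.sum_filter, Finset.sum_insert (by simp), Finset.sum_insert (by simp),
    Finset.sum_singleton]
  simp only [Nat.sub_zero, Nat.choose_zero_right, Nat.choose_one_right, Nat.sub_self,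
    Nat.reduceSub, hk, odd_one, if_true, one_ne_zero, if_false, OfNat.ofNat_ne_zero]
  split_ifs at hr ⊢ <;> omega
end

section
/- Let n ≥ 3 be odd. Then the n vectors u_i := v_{[n]∖{i}} ∈ F_2^{C(n,2)}, i ∈ [n], are linearly independent over F_2; consequently the span H_{n−1} of the (n−1)-clique vectors has dimension n. -/
open scoped BigOperators

/-- In a linear combination of the vectors `v_{[n] \ {i}}`, the coordinate at a pair is the sum of
all coefficients minus the two coefficients at the endpoints. -/
lemma sum_smul_cliqueVec_compl_apply {n : ℕ} (c : Fin n → ZMod 2) (p : PairIdx n) :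
    (∑ i, c i • cliqueVec n ({i}ᶜ : Finset (Fin n))) p = ∑ i, c i - c p.1.1 - c p.1.2 := by
  have hp : p.1.1 ≠ p.1.2 := p.2.ne
  have h (i : Fin n) : c i * cliqueVec n ({i}ᶜ : Finset (Fin n)) p =
      c i - (if p.1.1 = i then c i else 0) - (if p.1.2 = i then c i else 0) := by
    simp only [cliqueVec, Finset.mem_compl, Finset.mem_singleton]
    split_ifs <;> simp_all
  simp [Finset.sum_apply, h, Finset.sum_sub_distrib]

lemma linearIndependent_cliqueVec_compl {n : ℕ} (hn : 3 ≤ n) (hodd : Odd n) :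
    LinearIndependent (ZMod 2) (fun i : Fin n => cliqueVec n ({i}ᶜ : Finset (Fin n))) := by
  rw [Fintype.linearIndependent_iff]
  intro c hc
  have hlt {a b : Fin n} (hab : a < b) : ∑ i, c i = c a + c b := by
    let p : PairIdx n := ⟨(a, b), hab⟩
    have h : 0 = ∑ i, c i - c a - c b :=
      (congrFun hc p).symm.trans (sum_smul_cliqueVec_compl_apply c p)
    linear_combination -h
  have hne {a b : Fin n} (hab : a ≠ b) : ∑ i, c i = c a + c b := by
    rcases hab.lt_or_gt with h | h
    · exact hlt h
    · rw [hlt h, add_comm]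
  have hconst (a b : Fin n) : c a = c b := by
    obtain ⟨d, hd⟩ : ({a, b}ᶜ : Finset (Fin n)).Nonempty := by
      rw [← Finset.card_pos, Finset.card_compl, Fintype.card_fin]
      have := Finset.card_le_two (a := a) (b := b)
      omega
    simp only [Finset.mem_compl, Finset.mem_insert, Finset.mem_singleton, not_or] at hd
    exact add_right_cancel ((hne (Ne.symm hd.1)).symm.trans (hne (Ne.symm hd.2)))
  intro a
  have hsum : ∑ i, c i = c a := by
    rw [Finset.sum_congr rfl fun i _ => hconst i a]
    simp [(ZMod.natCast_eq_one_iff_odd).2 hodd]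
  obtain ⟨b, hb⟩ : ∃ b : Fin n, a ≠ b := by
    have : Nontrivial (Fin n) := Fin.nontrivial_iff_two_le.2 (by omega)
    exact (exists_ne a).imp fun _ h => h.symm
  rw [hconst a b]
  simpa [hsum] using hne hb

lemma Hk_pred_eq_span_range {n : ℕ} (hn : 1 ≤ n) :
    Hk n (n - 1) = Submodule.span (ZMod 2)
      (Set.range fun i : Fin n => cliqueVec n ({i}ᶜ : Finset (Fin n))) := by
  unfold Hk
  congr 1
  ext v
  constructor
  · rintro ⟨X, hX, rfl⟩
    have hX' : Xᶜ.card = 1 := by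
      rw [Finset.card_compl, Fintype.card_fin]
      omega
    obtain ⟨i, hi⟩ := Finset.card_eq_one.1 hX'
    exact ⟨i, by simp [← hi]⟩
  · rintro ⟨i, rfl⟩
    exact ⟨{i}ᶜ, by simp [Finset.card_compl], rfl⟩

/-- For odd `n ≥ 3`, the `n` vectors `u_i := v_{[n] \ {i}}` are linearly independent over
`F_2`; consequently the span `H_{n-1}` of the `(n-1)`-clique vectors has dimension `n`. -/
theorem cliqueVec_complement_linearIndependent_odd (n : ℕ) (hn : 3 ≤ n) (hodd : Odd n) :
    LinearIndependent (ZMod 2) (fun i : Fin n => cliqueVec n ({i}ᶜ : Finset (Fin n))) ∧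
    Module.finrank (ZMod 2) (Hk n (n - 1)) = n := by
  have hli := linearIndependent_cliqueVec_compl hn hodd
  refine ⟨hli, ?_⟩
  rw [Hk_pred_eq_span_range (by omega), finrank_span_eq_card hli, Fintype.card_fin]
end

section
/- Let n ≥ 4 be even. Then Σ_{i=1}^n v_{[n]∖{i}} = 0 in F_2^{C(n,2)}, while for every nonempty proper subset S ⊊ [n] one has Σ_{i∈S} v_{[n]∖{i}} ≠ 0; consequently the span H_{n−1} of the (n−1)-clique vectors has dimension exactly n − 1. -/
open scoped BigOperators

lemma sum_smul_cliqueVec_compl_eq_zero_iff {n : ℕ} (hn : 3 ≤ n) (heven : Even n)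
    (c : Fin n → ZMod 2) :
    ∑ i, c i • cliqueVec n ({i}ᶜ : Finset (Fin n)) = 0 ↔ ∀ i j, c i = c j := by
  constructor
  · intro h
    have key (a b : Fin n) (hab : a ≠ b) : c a + c b = ∑ i, c i := by
      have of_lt (x y : Fin n) (hxy : x < y) : c x + c y = ∑ i, c i := by
        let p : PairIdx n := ⟨(x, y), hxy⟩
        have : ∑ i, c i - c x - c y = 0 :=
          (sum_smul_cliqueVec_compl_apply c p).symm.trans (congrFun h p)
        linear_combination -this
      rcases hab.lt_or_gt with hlt | hlt
      · exact of_lt a b hlt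
      · rw [add_comm]
        exact of_lt b a hlt
    intro i j
    obtain ⟨k, hk⟩ : ∃ k, k ∉ ({i, j} : Finset (Fin n)) := by
      by_contra! hall
      have h1 := Finset.card_le_card (fun x _ => hall x : Finset.univ ⊆ {i, j})
      have h2 := Finset.card_le_two (a := i) (b := j)
      rw [Finset.card_univ, Fintype.card_fin] at h1
      omega
    simp only [Finset.mem_insert, Finset.mem_singleton, not_or] at hk
    exact add_right_cancel ((key i k (Ne.symm hk.1)).trans (key j k (Ne.symm hk.2)).symm)
  · intro h
    ext p
    have hn0 : (n : ZMod 2) = 0 := (ZMod.natCast_eq_zero_iff_even).2 heven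
    rw [sum_smul_cliqueVec_compl_apply, Finset.sum_congr rfl fun i _ => h i p.1.1, h p.1.2 p.1.1]
    simp [hn0, CharTwo.sub_eq_add]

lemma Hk_pred_eq_range_linearCombination {n : ℕ} (hn : 1 ≤ n) :
    Hk n (n - 1) = LinearMap.range (Fintype.linearCombination (ZMod 2)
      fun i => cliqueVec n ({i}ᶜ : Finset (Fin n))) := by
  rw [Fintype.range_linearCombination, Hk]
  congr 1
  ext v
  constructor
  · rintro ⟨X, hX, rfl⟩
    obtain ⟨i, hi⟩ : ∃ i, Xᶜ = {i} := by
      rw [← Finset.card_eq_one, Finset.card_compl, Fintype.card_fin]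
      omega
    exact ⟨i, by simp [← hi]⟩
  · rintro ⟨i, rfl⟩
    exact ⟨{i}ᶜ, by simp [Finset.card_compl], rfl⟩

lemma finrank_Hk_pred {n : ℕ} (hn : 3 ≤ n) (heven : Even n) :
    Module.finrank (ZMod 2) (Hk n (n - 1)) = n - 1 := by
  rw [Hk_pred_eq_range_linearCombination (by omega)]
  set f := Fintype.linearCombination (ZMod 2) fun i => cliqueVec n ({i}ᶜ : Finset (Fin n))
  have hker : LinearMap.ker f = Submodule.span (ZMod 2) {1} := by
    ext c
    rw [LinearMap.mem_ker, Fintype.linearCombination_apply,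
      sum_smul_cliqueVec_compl_eq_zero_iff hn heven, Submodule.mem_span_singleton]
    constructor
    · intro h
      exact ⟨c ⟨0, by omega⟩, by ext i; simp [h i ⟨0, by omega⟩]⟩
    · rintro ⟨a, rfl⟩ i j
      rfl
  have hone : (1 : Fin n → ZMod 2) ≠ 0 := fun h => one_ne_zero (congrFun h ⟨0, by omega⟩)
  have := f.finrank_range_add_finrank_ker
  rw [hker, finrank_span_singleton hone, Module.finrank_fin_fun] at this
  omega

/-- For even `n ≥ 4`: `Σ_{i=1}^n v_{[n] \ {i}} = 0` in `F_2^{C(n,2)}`, while for every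
nonempty proper subset `S ⊊ [n]` the sum `Σ_{i ∈ S} v_{[n] \ {i}}` is nonzero;
consequently the span `H_{n-1}` of the `(n-1)`-clique vectors has dimension exactly
`n - 1`. -/
theorem cliqueVec_complement_relations_even (n : ℕ) (hn : 4 ≤ n) (heven : Even n) :
    (∑ i : Fin n, cliqueVec n ({i}ᶜ : Finset (Fin n))) = 0 ∧
    (∀ S : Finset (Fin n), S.Nonempty → S ≠ Finset.univ →
      ∑ i ∈ S, cliqueVec n ({i}ᶜ : Finset (Fin n)) ≠ 0) ∧
    Module.finrank (ZMod 2) (Hk n (n - 1)) = n - 1 := by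
  refine ⟨?_, fun S hne huniv h => ?_, finrank_Hk_pred (by omega) heven⟩
  · simpa using (sum_smul_cliqueVec_compl_eq_zero_iff (by omega) heven fun _ => 1).2
      fun _ _ => rfl
  · obtain ⟨i, hi⟩ := hne
    obtain ⟨j, hj⟩ : ∃ j, j ∉ S := by
      by_contra! hall
      exact huniv (Finset.eq_univ_iff_forall.2 hall)
    have := (sum_smul_cliqueVec_compl_eq_zero_iff (by omega) heven
      fun i => if i ∈ S then 1 else 0).1 (by simpa [ite_smul] using h) i j
    simp [hi, hj] at this
end
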